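/- Group-invariance lemma for resampled order statistics. Let G = {π₁, …, π_r} be a finite set of bijections of a set Ω onto itself which forms a group under composition, let f : Ω → ℝ be any function, and let 1 ≤ s ≤ r. For ω ∈ Ω define q(ω) to be the s-th smallest value among the multiset {f(π₁(ω)), …, f(π_r(ω))}. Then: (i) q(π_i(ω)) = q(ω) for every i and every ω ∈ Ω; and (ii) for every ω ∈ Ω, the number of indices i ∈ {1,…,r} with f(π_i(ω)) > q(ω) is at most r − s. In particular, if s = r − ⌊αr⌋ for 0 ≤ α ≤ 1, then #{i : f(π_i(ω)) > q(π_i(ω))} ≤ rα. -/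

import Mathlib

open Classical

/-- The `s`-th smallest value (counted with multiplicity) among `x 1, …, x r`. -/
noncomputable def sortedNth {r : ℕ} (x : Fin r → ℝ) (s : ℕ) : ℝ :=
  ((List.ofFn x).insertionSort (· ≤ ·)).getD (s - 1) 0

theorem sortedNth_comp_perm {r : ℕ} (x : Fin r → ℝ) (σ : Equiv.Perm (Fin r)) (s : ℕ) :
    sortedNth (x ∘ σ) s = sortedNth x s := by
  have h : (List.ofFn (x ∘ σ)).insertionSort (· ≤ ·) = (List.ofFn x).insertionSort (· ≤ ·) :=
    List.Perm.eq_of_pairwise'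
      (List.pairwise_insertionSort _ _) (List.pairwise_insertionSort _ _)
      (((List.perm_insertionSort _ _).trans (Equiv.Perm.ofFn_comp_perm σ x)).trans
        (List.perm_insertionSort _ _).symm)
  rw [sortedNth, sortedNth, h]

theorem countP_lt_getD_le_of_pairwise {l : List ℝ} (hl : l.Pairwise (· ≤ ·)) {s : ℕ}
    (hs1 : 1 ≤ s) (hs : s ≤ l.length) :
    l.countP (fun a => decide (l.getD (s - 1) 0 < a)) ≤ l.length - s := by
  have hlt : s - 1 < l.length := by omega
  have htake : (l.take s).countP (fun a => decide (l.getD (s - 1) 0 < a)) = 0 := by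
    rw [List.countP_eq_zero]
    intro a ha
    obtain ⟨i, hi, rfl⟩ := List.mem_iff_getElem.mp ha
    rw [List.length_take] at hi
    rw [List.getElem_take, List.getD_eq_getElem _ _ hlt, decide_eq_true_eq, not_lt]
    exact hl.rel_get_of_le (a := ⟨i, by omega⟩) (b := ⟨s - 1, hlt⟩)
      (Fin.mk_le_mk.mpr (by omega))
  conv_lhs => rw [← List.take_append_drop s l, List.countP_append]
  rw [List.take_append_drop, htake, zero_add]
  exact List.countP_le_length.trans_eq List.length_drop

theorem card_filter_univ_eq_countP_ofFn {r : ℕ} {β : Type*} (x : Fin r → β) (p : β → Prop)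
    [DecidablePred p] :
    (Finset.univ.filter fun i => p (x i)).card = (List.ofFn x).countP (fun a => decide (p a)) := by
  rw [← Multiset.coe_countP, ← Fin.univ_val_map, Multiset.countP_map]
  rfl

theorem card_sortedNth_lt_le {r : ℕ} (x : Fin r → ℝ) {s : ℕ} (hs1 : 1 ≤ s) (hsr : s ≤ r) :
    (Finset.univ.filter fun i => sortedNth x s < x i).card ≤ r - s := by
  have hlen : ((List.ofFn x).insertionSort (· ≤ ·)).length = r := by simp
  have h := countP_lt_getD_le_of_pairwise
    (List.pairwise_insertionSort (· ≤ ·) (List.ofFn x)) hs1 (hsr.trans_eq hlen.symm)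
  rw [hlen, (List.perm_insertionSort (· ≤ ·) (List.ofFn x)).countP_eq] at h
  rw [card_filter_univ_eq_countP_ofFn x (sortedNth x s < ·)]
  exact h

/-- **Group-invariance lemma for resampled order statistics.**  Let
`G = {π 1, …, π r}` be a finite set of (distinct) bijections of `Ω` forming a
group under composition, `f : Ω → ℝ` any function, `1 ≤ s ≤ r`, and
`q ω` the `s`-th smallest value among `f (π 1 ω), …, f (π r ω)`.  Then
(i) `q (π i ω) = q ω` for all `i, ω`;
(ii) `#{i : f (π i ω) > q ω} ≤ r - s` for all `ω`; and
(iii) if `s = r - ⌊αr⌋` with `0 ≤ α ≤ 1`, then `#{i : f (π i ω) > q (π i ω)} ≤ rα`. -/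
theorem group_invariance_resampled_order_statistics
    {Ω : Type*} (r : ℕ) (hr : 0 < r)
    (π : Fin r → Ω → Ω)
    (hbij : ∀ i, Function.Bijective (π i))
    (hπinj : Function.Injective π)
    (hπcomp : ∀ i j : Fin r, ∃ k : Fin r, π i ∘ π j = π k)
    (hπinv : ∀ i : Fin r, ∃ j : Fin r, π i ∘ π j = id)
    (f : Ω → ℝ) (s : ℕ) (hs1 : 1 ≤ s) (hsr : s ≤ r)
    (q : Ω → ℝ) (hq : ∀ ω, q ω = sortedNth (fun i => f (π i ω)) s)
    (α : ℝ) (hα0 : 0 ≤ α) (hα1 : α ≤ 1) :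
    (∀ (i : Fin r) (ω : Ω), q (π i ω) = q ω) ∧
    (∀ ω : Ω, (Finset.univ.filter fun i : Fin r => q ω < f (π i ω)).card ≤ r - s) ∧
    (s = r - Nat.floor (α * r) →
      ∀ ω : Ω,
        ((Finset.univ.filter fun i : Fin r => q (π i ω) < f (π i ω)).card : ℝ)
          ≤ r * α) := by
  have hinv : ∀ (i : Fin r) (ω : Ω), q (π i ω) = q ω := by
    intro i ω
    choose σ hσ using fun j => hπcomp j i
    have hσinj : Function.Injective σ := fun a b hab =>
      hπinj ((hbij i).surjective.injective_comp_right (by simp only [hσ, hab]))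
    rw [hq, hq, ← sortedNth_comp_perm (fun j => f (π j ω))
      (Equiv.ofBijective σ (Finite.injective_iff_bijective.mp hσinj)) s]
    congr 1
    funext j
    exact congrArg f (congrFun (hσ j) ω)
  have hcard : ∀ ω : Ω,
      (Finset.univ.filter fun i : Fin r => q ω < f (π i ω)).card ≤ r - s := by
    intro ω
    rw [hq]
    exact card_sortedNth_lt_le (fun i => f (π i ω)) hs1 hsr
  refine ⟨hinv, hcard, fun hs ω => ?_⟩
  simp only [hinv]
  have hfloor : r - s ≤ ⌊α * r⌋₊ := by omega
  calc ((Finset.univ.filter fun i : Fin r => q ω < f (π i ω)).card : ℝ)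
      ≤ (⌊α * r⌋₊ : ℝ) := by exact_mod_cast (hcard ω).trans hfloor
    _ ≤ α * r := Nat.floor_le (by positivity)
    _ = r * α := mul_comm _ _
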